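/- arXiv:1709.05997 — 2 statements merged into one kernel-verified Lean document; each statement's English description precedes it below -/
import Mathlib

section
/- Let k₁, k₂ > 0 and 0 < c < 1. For k > 0 define operators on functions g : ℕ → ℂ by (H_k g)(n) = 2(k+n)·g(n), (E_k g)(n) = (n/√c)·g(n−1) (zero when n = 0), (F_k g)(n) = −√c·(2k+n)·g(n+1). For f : ℕ² → ℂ let these operators act in the indicated variable (subscript 1 for n₁, subscript 2 for n₂). Then for all f : ℕ² → ℂ and (n₁,n₂) ∈ ℕ²: −(1/2)·(H_{k₁}⊗H_{k₂} f)(n₁,n₂) − (F_{k₁}⊗E_{k₂} f)(n₁,n₂) − (E_{k₁}⊗F_{k₂} f)(n₁,n₂) + 2k₁k₂·f(n₁,n₂) = n₁(2k₂+n₂)·(f(n₁−1,n₂+1) − f(n₁,n₂)) + n₂(2k₁+n₁)·(f(n₁+1,n₂−1) − f(n₁,n₂)). -/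
/-- The su(1,1) generator `H` in the discrete series representation `π_k`. -/
noncomputable def Hop (k : ℝ) (g : ℕ → ℂ) : ℕ → ℂ :=
  fun n => 2 * ((k : ℂ) + n) * g n

/-- The su(1,1) generator `E` in `π_k`; the term vanishes when `n = 0`. -/
noncomputable def Eop (c : ℝ) (g : ℕ → ℂ) : ℕ → ℂ :=
  fun n => ((n : ℂ) / (Real.sqrt c : ℂ)) * g (n - 1)

/-- The su(1,1) generator `F` in `π_k`. -/
noncomputable def Fop (c k : ℝ) (g : ℕ → ℂ) : ℕ → ℂ :=
  fun n => -(Real.sqrt c : ℂ) * (2 * k + n) * g (n + 1)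

/-- Action of an operator in the first variable. -/
def op1 (A : (ℕ → ℂ) → ℕ → ℂ) (f : ℕ → ℕ → ℂ) : ℕ → ℕ → ℂ :=
  fun n₁ n₂ => A (fun m => f m n₂) n₁

/-- Action of an operator in the second variable. -/
def op2 (A : (ℕ → ℂ) → ℕ → ℂ) (f : ℕ → ℕ → ℂ) : ℕ → ℕ → ℂ :=
  fun n₁ n₂ => A (fun m => f n₁ m) n₂

theorem stmt8 (k₁ k₂ c : ℝ) (hk₁ : 0 < k₁) (hk₂ : 0 < k₂)
    (hc : 0 < c) (hc1 : c < 1) (f : ℕ → ℕ → ℂ) (n₁ n₂ : ℕ) :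
    -(1 / 2) * op1 (Hop k₁) (op2 (Hop k₂) f) n₁ n₂
      - op1 (Fop c k₁) (op2 (Eop c) f) n₁ n₂
      - op1 (Eop c) (op2 (Fop c k₂) f) n₁ n₂
      + 2 * k₁ * k₂ * f n₁ n₂ =
    (n₁ : ℂ) * (2 * k₂ + n₂) * (f (n₁ - 1) (n₂ + 1) - f n₁ n₂)
      + (n₂ : ℂ) * (2 * k₁ + n₁) * (f (n₁ + 1) (n₂ - 1) - f n₁ n₂) := by
  have hs : (Real.sqrt c : ℂ) ≠ 0 := by
    exact_mod_cast (Real.sqrt_pos.mpr hc).ne'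
  simp only [op1, op2, Hop, Eop, Fop]
  field_simp
  ring
end

section
/- Let k > 0 and define J(x,y;k) = 2^{1−2k}·e^{(x+y)/2}·Σ_{m=0}^{∞} (−1)^m·(xy/4)^m / (m!·Γ(2k+m)) for x, y ∈ (0,∞). Then for all x, y ∈ (0,∞): −2x·(∂²J/∂x²)(x,y;k) − 2(2k−x)·(∂J/∂x)(x,y;k) + (1/2)(4k−x)·J(x,y;k) = (1/2)·y·J(x,y;k). -/
/-- The Bessel-type kernel
`J(x,y;k) = 2^{1-2k} e^{(x+y)/2} Σ_{m} (-1)^m (xy/4)^m/(m! Γ(2k+m))`. -/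
noncomputable def J (k x y : ℝ) : ℝ :=
  (2 : ℝ) ^ (1 - 2 * k) * Real.exp ((x + y) / 2) *
    ∑' m : ℕ, (-1 : ℝ) ^ m * (x * y / 4) ^ m /
      ((Nat.factorial m : ℝ) * Real.Gamma (2 * k + m))

/-- The entire function `z ↦ ∑ (-1)^m z^m / (m! Γ(b+m))`, through which Bessel functions of the
first kind of order `b - 1` are expressed. -/
noncomputable def besselSeries (b z : ℝ) : ℝ :=
  ∑' m : ℕ, (-1 : ℝ) ^ m * z ^ m / ((Nat.factorial m : ℝ) * Real.Gamma (b + m))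

theorem Gamma_add_one_le_Gamma_add_one_add_nat {b : ℝ} (hb : 0 < b) (m : ℕ) :
    Real.Gamma (b + 1) ≤ Real.Gamma (b + 1 + m) := by
  induction m with
  | zero => simp
  | succ m ih =>
    have hm : (0 : ℝ) ≤ m := m.cast_nonneg
    have hpos : 0 < Real.Gamma (b + 1 + m) := Real.Gamma_pos_of_pos (by positivity)
    rw [Nat.cast_succ, ← add_assoc, Real.Gamma_add_one (s := b + 1 + m) (by positivity)]
    nlinarith

theorem summable_pow_div_factorial_mul_Gamma {b : ℝ} (hb : 0 < b) {R : ℝ} (hR : 0 ≤ R) :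
    Summable fun m : ℕ => R ^ m / ((Nat.factorial m : ℝ) * Real.Gamma (b + m)) := by
  rw [← summable_nat_add_iff 1]
  have hG : 0 < Real.Gamma (b + 1) := Real.Gamma_pos_of_pos (by positivity)
  refine Summable.of_nonneg_of_le (fun m => ?_) (fun m => ?_)
    (((summable_nat_add_iff 1).2 (Real.summable_pow_div_factorial R)).div_const
      (Real.Gamma (b + 1)))
  · have := Real.Gamma_pos_of_pos (s := b + ((m + 1 : ℕ) : ℝ)) (by positivity)
    positivity
  · have h := Gamma_add_one_le_Gamma_add_one_add_nat hb m
    rw [div_div, show b + ((m + 1 : ℕ) : ℝ) = b + 1 + m by push_cast; ring]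
    gcongr

theorem summable_besselSeries {b : ℝ} (hb : 0 < b) (z : ℝ) :
    Summable fun m : ℕ => (-1 : ℝ) ^ m * z ^ m / ((Nat.factorial m : ℝ) * Real.Gamma (b + m)) := by
  refine .of_norm ((summable_pow_div_factorial_mul_Gamma hb (abs_nonneg z)).congr fun m => ?_)
  have := Real.Gamma_pos_of_pos (s := b + (m : ℝ)) (by positivity)
  simp [abs_of_pos this]

theorem besselSeries_deriv_term (b z : ℝ) (m : ℕ) :
    (-1 : ℝ) ^ (m + 1) * (((m + 1 : ℕ) : ℝ) * z ^ m) /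
        ((Nat.factorial (m + 1) : ℝ) * Real.Gamma (b + (m + 1 : ℕ))) =
      -((-1 : ℝ) ^ m * z ^ m / ((Nat.factorial m : ℝ) * Real.Gamma (b + 1 + m))) := by
  rw [show b + ((m + 1 : ℕ) : ℝ) = b + 1 + m by push_cast; ring, Nat.factorial_succ, Nat.cast_mul]
  have h : ((m + 1 : ℕ) : ℝ) ≠ 0 := by positivity
  rw [mul_left_comm, mul_assoc ((m + 1 : ℕ) : ℝ), mul_div_mul_left _ _ h, pow_succ]
  ring

theorem hasDerivAt_besselSeries {b : ℝ} (hb : 0 < b) (z : ℝ) :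
    HasDerivAt (besselSeries b) (-besselSeries (b + 1) z) z := by
  have hz : z ∈ Metric.ball (0 : ℝ) (|z| + 1) := by simp
  have hu : Summable fun m : ℕ => (m : ℝ) * (|z| + 1) ^ (m - 1) /
      ((Nat.factorial m : ℝ) * Real.Gamma (b + m)) := by
    rw [← summable_nat_add_iff 1]
    refine (summable_pow_div_factorial_mul_Gamma (b := b + 1) (by positivity)
      (R := |z| + 1) (by positivity)).congr fun m => ?_
    rw [show b + ((m + 1 : ℕ) : ℝ) = b + 1 + m by push_cast; ring, Nat.factorial_succ,
      Nat.cast_mul, mul_assoc, Nat.add_sub_cancel, mul_div_mul_left _ _ (by positivity)]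
  have key := hasDerivAt_tsum_of_isPreconnected hu Metric.isOpen_ball
    (convex_ball (0 : ℝ) (|z| + 1)).isPreconnected
    (g := fun m w => (-1 : ℝ) ^ m * w ^ m / ((Nat.factorial m : ℝ) * Real.Gamma (b + m)))
    (g' := fun m w => (-1 : ℝ) ^ m * ((m : ℝ) * w ^ (m - 1)) /
      ((Nat.factorial m : ℝ) * Real.Gamma (b + m)))
    (fun m w _ => ((hasDerivAt_pow m w).const_mul _).div_const _)
    (fun m w hw => by
      have hG := Real.Gamma_pos_of_pos (s := b + (m : ℝ)) (by positivity)
      have hw' : |w| ≤ |z| + 1 := by simpa using (mem_ball_zero_iff.1 hw).le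
      simp only [norm_div, norm_mul, norm_pow, norm_neg, norm_one, one_pow, one_mul,
        Real.norm_eq_abs, Nat.abs_cast, abs_of_pos hG]
      gcongr)
    hz (summable_besselSeries hb z) hz
  refine key.congr_deriv ?_
  rw [tsum_eq_zero_add']
  · simp only [Nat.add_sub_cancel, besselSeries_deriv_term, tsum_neg, besselSeries]
    simp
  · simp only [Nat.add_sub_cancel, besselSeries_deriv_term]
    exact (summable_besselSeries (by positivity) z).neg

theorem besselSeries_recurrence {b : ℝ} (hb : 0 < b) (z : ℝ) :
    z * besselSeries (b + 2) z - b * besselSeries (b + 1) z + besselSeries b z = 0 := by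
  have h0 := summable_besselSeries hb z
  have h1 := summable_besselSeries (b := b + 1) (by positivity) z
  have hdiff : besselSeries b z - b * besselSeries (b + 1) z =
      ∑' m : ℕ, (m : ℝ) * ((-1 : ℝ) ^ m * z ^ m /
        ((Nat.factorial m : ℝ) * Real.Gamma (b + 1 + m))) := by
    rw [besselSeries, besselSeries, ← tsum_mul_left, ← h0.tsum_sub (h1.mul_left b)]
    refine tsum_congr fun m => ?_
    have hbm : 0 < b + m := by positivity
    have hG := Real.Gamma_pos_of_pos hbm
    rw [show b + 1 + (m : ℝ) = b + m + 1 by ring, Real.Gamma_add_one hbm.ne']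
    field_simp
    ring
  have hterm (m : ℕ) : ((m + 1 : ℕ) : ℝ) * ((-1 : ℝ) ^ (m + 1) * z ^ (m + 1) /
      ((Nat.factorial (m + 1) : ℝ) * Real.Gamma (b + 1 + (m + 1 : ℕ)))) =
      -z * ((-1 : ℝ) ^ m * z ^ m / ((Nat.factorial m : ℝ) * Real.Gamma (b + 2 + m))) := by
    have h := besselSeries_deriv_term (b + 1) z m
    rw [show b + 1 + 1 = b + 2 by ring] at h
    linear_combination z * h
  have hsum : (∑' m : ℕ, (m : ℝ) * ((-1 : ℝ) ^ m * z ^ m /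
      ((Nat.factorial m : ℝ) * Real.Gamma (b + 1 + m)))) = -z * besselSeries (b + 2) z := by
    rw [tsum_eq_zero_add']
    · simp only [hterm, tsum_mul_left, besselSeries]
      simp
    · simp only [hterm]
      exact (summable_besselSeries (by positivity) z).mul_left _
  linear_combination hdiff + hsum

theorem hasDerivAt_exp_mul_besselSeries {b : ℝ} (hb : 0 < b) (y t : ℝ) :
    HasDerivAt (fun t => Real.exp ((t + y) / 2) * besselSeries b (t * y / 4))
      (Real.exp ((t + y) / 2) * besselSeries b (t * y / 4) / 2 -
        y / 4 * (Real.exp ((t + y) / 2) * besselSeries (b + 1) (t * y / 4))) t := by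
  have he : HasDerivAt (fun t => Real.exp ((t + y) / 2)) (Real.exp ((t + y) / 2) * (1 / 2)) t :=
    (((hasDerivAt_id t).add_const y).div_const 2).exp
  have hl : HasDerivAt (fun t : ℝ => t * y / 4) (1 * y / 4) t :=
    ((hasDerivAt_id t).mul_const y).div_const 4
  have hs := (hasDerivAt_besselSeries hb (t * y / 4)).comp t hl
  refine (he.mul hs).congr_deriv ?_
  simp only [Function.comp_apply]
  ring

theorem stmt17 (k : ℝ) (hk : 0 < k) (x y : ℝ) (hx : 0 < x) (hy : 0 < y) :
    -2 * x * deriv (deriv (fun t => J k t y)) x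
      - 2 * (2 * k - x) * deriv (fun t => J k t y) x
      + (1 / 2) * (4 * k - x) * J k x y =
    (1 / 2) * y * J k x y := by
  have hb : 0 < 2 * k := by positivity
  set c : ℝ := (2 : ℝ) ^ (1 - 2 * k)
  have hJ (t : ℝ) :
      J k t y = c * (Real.exp ((t + y) / 2) * besselSeries (2 * k) (t * y / 4)) := by
    rw [J, besselSeries, mul_assoc]
  have hd (t : ℝ) := (hasDerivAt_exp_mul_besselSeries hb y t).const_mul c
  have hd' := (((hasDerivAt_exp_mul_besselSeries hb y x).div_const 2).sub
    ((hasDerivAt_exp_mul_besselSeries (b := 2 * k + 1) (by positivity) y x).const_mul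
      (y / 4))).const_mul c
  have hderiv := funext fun t => (hd t).deriv
  simp only [hJ]
  rw [show deriv (deriv _) x = _ from (congrArg (deriv · x) hderiv).trans hd'.deriv, (hd x).deriv,
    show 2 * k + 1 + 1 = 2 * k + 2 by ring]
  linear_combination
    -(c * Real.exp ((x + y) / 2) * y / 2) * besselSeries_recurrence hb (x * y / 4)
end
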